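/- Suppose m ≥ 2. Then for every λ ∈ (0,∞)^m, R(λ^O, λ) < R(λ^ML, λ); that is, the shrinkage estimator λ^O strictly dominates the maximum likelihood estimator λ^ML at every parameter point under the standardized squared error loss. -/

import Mathlib

open scoped BigOperators ENNReal

/-- The Poisson(μ) probability of the value `k`. -/
noncomputable def poissonPmf (mu : ℝ) (k : ℕ) : ℝ :=
  mu ^ k * Real.exp (-mu) / (Nat.factorial k)

/-- Joint pmf of (X, Y): X_1, …, X_m, Y independent, X_i ~ Po(λ_i), Y ~ Po(Σ λ_i). -/
noncomputable def jointPmf (m : ℕ) (lam : Fin m → ℝ) (x : Fin m → ℕ) (y : ℕ) : ℝ :=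
  poissonPmf (∑ i, lam i) y * ∏ i, poissonPmf (lam i) (x i)

/-- Risk of an estimator δ under the standardized squared error loss, valued in [0,∞]. -/
noncomputable def risk (m : ℕ) (δ : (Fin m → ℕ) → ℕ → Fin m → ℝ) (lam : Fin m → ℝ) : ℝ≥0∞ :=
  ∑' x : Fin m → ℕ, ∑' y : ℕ,
    ENNReal.ofReal ((∑ i, (δ x y i - lam i) ^ 2 / lam i) * jointPmf m lam x y)

/-- The maximum likelihood estimator λ^ML (real division by zero is 0, giving 0/0 = 0). -/
noncomputable def estML (m : ℕ) (x : Fin m → ℕ) (y : ℕ) (i : Fin m) : ℝ :=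
  ((∑ j, (x j : ℝ)) + (y : ℝ)) / 2 * ((x i : ℝ) / ∑ j, (x j : ℝ))

/-- The shrinkage estimator λ^O. -/
noncomputable def estO (m : ℕ) (x : Fin m → ℕ) (y : ℕ) (i : Fin m) : ℝ :=
  ((∑ j, (x j : ℝ)) + (y : ℝ) + (m : ℝ) - 1) / 2 *
    ((x i : ℝ) / ((∑ j, (x j : ℝ)) + (m : ℝ) - 1))

/-- The second shrinkage estimator λ̂. -/
noncomputable def estHat (m : ℕ) (x : Fin m → ℕ) (y : ℕ) (i : Fin m) : ℝ :=
  ((∑ j, (x j : ℝ)) + (y : ℝ)) / 2 * ((x i : ℝ) / ((∑ j, (x j : ℝ)) + (m : ℝ) - 1))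

/-- The Clevenson–Zidek estimator λ̂X based on X alone. -/
noncomputable def estCZ (m : ℕ) (x : Fin m → ℕ) (y : ℕ) (i : Fin m) : ℝ :=
  (∑ j, (x j : ℝ)) * (x i : ℝ) / ((∑ j, (x j : ℝ)) + (m : ℝ) - 1)

lemma HasSum.congr_of_eq {α : Type*} {f g : α → ℝ} {a b : ℝ} (h : HasSum f a)
    (hfg : ∀ x, g x = f x) (hab : b = a) : HasSum g b := by
  rw [hab, funext hfg]
  exact h

lemma poissonPmf_pos {mu : ℝ} (hmu : 0 < mu) (k : ℕ) : 0 < poissonPmf mu k := by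
  unfold poissonPmf
  positivity

lemma succ_mul_poissonPmf_succ (mu : ℝ) (k : ℕ) :
    ((k : ℝ) + 1) * poissonPmf mu (k + 1) = mu * poissonPmf mu k := by
  have : ((k : ℝ) + 1) ≠ 0 := by positivity
  have : (Nat.factorial k : ℝ) ≠ 0 := by positivity
  unfold poissonPmf
  rw [Nat.factorial_succ]
  push_cast
  field_simp
  ring

lemma hasSum_poissonPmf (mu : ℝ) : HasSum (poissonPmf mu) 1 := by
  have h := (NormedSpace.expSeries_div_hasSum_exp mu).mul_right (Real.exp (-mu))
  rw [← Real.exp_eq_exp_ℝ, ← Real.exp_add, add_neg_cancel, Real.exp_zero] at h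
  refine h.congr_fun fun k ↦ ?_
  unfold poissonPmf
  ring

/-- The Stein–Chen identity for the Poisson distribution. -/
lemma HasSum.stein_poissonPmf {mu : ℝ} {f : ℕ → ℝ} {a : ℝ}
    (h : HasSum (fun k ↦ f (k + 1) * poissonPmf mu k) a) :
    HasSum (fun k : ℕ ↦ (k : ℝ) * f k * poissonPmf mu k) (mu * a) := by
  rw [← hasSum_nat_add_iff' 1]
  refine (h.mul_left mu).congr_of_eq (fun k ↦ ?_) (by simp)
  push_cast
  linear_combination f (k + 1) * succ_mul_poissonPmf_succ mu k

lemma hasSum_id_mul_poissonPmf (mu : ℝ) : HasSum (fun k : ℕ ↦ (k : ℝ) * poissonPmf mu k) mu := by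
  refine (HasSum.stein_poissonPmf (mu := mu) (f := fun _ ↦ 1) (a := 1) ?_).congr_of_eq (by simp) (by simp)
  simpa only [one_mul] using hasSum_poissonPmf mu

lemma hasSum_sq_mul_poissonPmf (mu : ℝ) :
    HasSum (fun k : ℕ ↦ (k : ℝ) ^ 2 * poissonPmf mu k) (mu ^ 2 + mu) := by
  have h : HasSum (fun k : ℕ ↦ ((k + 1 : ℕ) : ℝ) * poissonPmf mu k) (mu + 1) := by
    refine ((hasSum_id_mul_poissonPmf mu).add (hasSum_poissonPmf mu)).congr_fun fun k ↦ ?_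
    push_cast
    ring
  exact (HasSum.stein_poissonPmf (f := fun k ↦ k) h).congr_of_eq (fun k ↦ by ring) (by ring)

/-- The pmf of a vector of independent Poisson variables. -/
noncomputable def poissonVecPmf {m : ℕ} (lam : Fin m → ℝ) (x : Fin m → ℕ) : ℝ :=
  ∏ i, poissonPmf (lam i) (x i)

lemma poissonVecPmf_pos {m : ℕ} {lam : Fin m → ℝ} (hlam : ∀ i, 0 < lam i) (x : Fin m → ℕ) :
    0 < poissonVecPmf lam x :=
  Finset.prod_pos fun i _ ↦ poissonPmf_pos (hlam i) _

lemma summable_poissonVecPmf {m : ℕ} {lam : Fin m → ℝ} (hlam : ∀ i, 0 < lam i) :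
    Summable (poissonVecPmf lam) := by
  induction m with
  | zero => exact Summable.of_finite
  | succ n ih =>
    rw [← (Fin.consEquiv fun _ ↦ ℕ).summable_iff]
    refine ((hasSum_poissonPmf (lam 0)).summable.mul_of_nonneg
      (ih (lam := fun i ↦ lam i.succ) fun i ↦ hlam _)
      (fun k ↦ (poissonPmf_pos (hlam 0) k).le)
      (fun x ↦ (poissonVecPmf_pos (lam := fun i ↦ lam i.succ)
        (fun i ↦ hlam _) x).le)).congr fun p ↦ ?_
    simp [poissonVecPmf, Fin.prod_univ_succ, Fin.consEquiv]

lemma poissonVecPmf_add_single {m : ℕ} (lam : Fin m → ℝ) (i : Fin m) (x : Fin m → ℕ) :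
    ((x i : ℝ) + 1) * poissonVecPmf lam (x + Pi.single i 1) = lam i * poissonVecPmf lam x := by
  unfold poissonVecPmf
  rw [← Finset.mul_prod_erase _ _ (Finset.mem_univ i),
    ← Finset.mul_prod_erase _ (fun j ↦ poissonPmf (lam j) (x j)) (Finset.mem_univ i)]
  have h : ∏ j ∈ Finset.univ.erase i, poissonPmf (lam j) ((x + Pi.single i 1 : Fin m → ℕ) j) =
      ∏ j ∈ Finset.univ.erase i, poissonPmf (lam j) (x j) :=
    Finset.prod_congr rfl fun j hj ↦ by simp [Finset.ne_of_mem_erase hj]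
  rw [h, Pi.add_apply, Pi.single_eq_same, ← mul_assoc, ← mul_assoc, succ_mul_poissonPmf_succ]

/-- The Stein–Chen identity in one coordinate of a vector of independent Poisson variables. -/
lemma HasSum.stein_poissonVecPmf {m : ℕ} {lam : Fin m → ℝ} {i : Fin m}
    {f : (Fin m → ℕ) → ℝ} {a : ℝ}
    (h : HasSum (fun x ↦ f (x + Pi.single i 1) * poissonVecPmf lam x) a) :
    HasSum (fun x ↦ (x i : ℝ) * f x * poissonVecPmf lam x) (lam i * a) := by
  have hinj : Function.Injective fun x : Fin m → ℕ ↦ x + Pi.single i 1 := add_left_injective _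
  rw [← hinj.hasSum_iff]
  · refine (h.mul_left (lam i)).congr_fun fun x ↦ ?_
    simp only [Function.comp_apply, Pi.add_apply, Pi.single_eq_same]
    push_cast
    linear_combination f (x + Pi.single i 1) * poissonVecPmf_add_single lam i x
  · intro x hx
    have : x i = 0 := by
      by_contra hne
      refine hx ⟨x - Pi.single i 1, ?_⟩
      funext j
      rcases eq_or_ne j i with rfl | hj
      · simp only [Pi.add_apply, Pi.sub_apply, Pi.single_eq_same]
        omega
      · simp [hj]
    simp [this]

lemma sum_add_single {m : ℕ} (x : Fin m → ℕ) (i : Fin m) :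
    ∑ j, (x + Pi.single i 1 : Fin m → ℕ) j = ∑ j, x j + 1 := by
  simp [Finset.sum_add_distrib]

/-- The Stein–Chen identity for the total of a vector of independent Poisson variables. -/
lemma HasSum.stein_poissonVecPmf_sum {m : ℕ} {lam : Fin m → ℝ} {F : ℕ → ℝ} {a : ℝ}
    (h : HasSum (fun x ↦ F (∑ j, x j + 1) * poissonVecPmf lam x) a) :
    HasSum (fun x : Fin m → ℕ ↦ ((∑ j, x j : ℕ) : ℝ) * F (∑ j, x j) * poissonVecPmf lam x)
      ((∑ i, lam i) * a) := by
  rw [Finset.sum_mul]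
  refine (hasSum_sum (s := Finset.univ) fun i _ ↦
    HasSum.stein_poissonVecPmf (i := i) (f := fun x ↦ F (∑ j, x j)) (a := a)
      (by simpa only [sum_add_single] using h)).congr_fun fun x ↦ ?_
  push_cast
  simp only [Finset.sum_mul]

section Bounded

variable {m : ℕ} {lam : Fin m → ℝ} {F : ℕ → ℝ} {C : ℝ}

lemma summable_poissonVecPmf_of_bounded (hlam : ∀ i, 0 < lam i) (hF : ∀ n, |F n| ≤ C) :
    Summable fun x ↦ F (∑ j, x j) * poissonVecPmf lam x := by
  refine Summable.of_norm_bounded ((summable_poissonVecPmf hlam).mul_left C) fun x ↦ ?_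
  rw [norm_mul, Real.norm_eq_abs, Real.norm_of_nonneg (poissonVecPmf_pos hlam x).le]
  exact mul_le_mul_of_nonneg_right (hF _) (poissonVecPmf_pos hlam x).le

lemma summable_coord_mul_poissonVecPmf (hlam : ∀ i, 0 < lam i) (hF : ∀ n, |F n| ≤ C) (i : Fin m) :
    Summable fun x : Fin m → ℕ ↦ (x i : ℝ) * F (∑ j, x j) * poissonVecPmf lam x := by
  have h := (summable_poissonVecPmf_of_bounded (F := fun n ↦ F (n + 1)) hlam fun _ ↦ hF _).hasSum
  exact (HasSum.stein_poissonVecPmf (i := i) (f := fun x ↦ F (∑ j, x j))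
    (by simpa only [sum_add_single] using h)).summable

lemma summable_sum_mul_poissonVecPmf (hlam : ∀ i, 0 < lam i) (hF : ∀ n, |F n| ≤ C) :
    Summable fun x : Fin m → ℕ ↦
      ((∑ j, x j : ℕ) : ℝ) * F (∑ j, x j) * poissonVecPmf lam x :=
  (HasSum.stein_poissonVecPmf_sum (summable_poissonVecPmf_of_bounded (F := fun n ↦ F (n + 1))
    hlam fun _ ↦ hF _).hasSum).summable

/-- Conditionally on its total `z`, a vector of independent Poisson variables satisfies
`E[∑ xᵢ² / λᵢ] = z (z + m - 1) / Λ`; here integrated against a bounded function of `z`. -/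
lemma exists_hasSum_sum_sq_div (hlam : ∀ i, 0 < lam i) (hL : 0 < ∑ i, lam i)
    (hF : ∀ n, |F n| ≤ C) :
    ∃ T, HasSum (fun x : Fin m → ℕ ↦
        (∑ i, (x i : ℝ) ^ 2 / lam i) * F (∑ j, x j) * poissonVecPmf lam x) T ∧
      HasSum (fun x : Fin m → ℕ ↦ ((∑ j, x j : ℕ) : ℝ) * (((∑ j, x j : ℕ) : ℝ) + m - 1) /
        (∑ i, lam i) * F (∑ j, x j) * poissonVecPmf lam x) T := by
  have hF' : ∀ n, |F (n + 1)| ≤ C := fun n ↦ hF _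
  have h0 := summable_poissonVecPmf_of_bounded (F := fun n ↦ F (n + 1)) hlam hF'
  have hc := fun i ↦ ((summable_coord_mul_poissonVecPmf (F := fun n ↦ F (n + 1)) hlam hF' i).add
    h0).hasSum
  set c : Fin m → ℝ := fun i ↦ ∑' x : Fin m → ℕ, ((x i : ℝ) * F (∑ j, x j + 1) *
    poissonVecPmf lam x + F (∑ j, x j + 1) * poissonVecPmf lam x)
  refine ⟨∑ i, c i, ?_, ?_⟩
  · have h : ∀ i, HasSum (fun x : Fin m → ℕ ↦
        (x i : ℝ) * ((x i : ℝ) * F (∑ j, x j)) * poissonVecPmf lam x) (lam i * c i) := fun i ↦ by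
      refine HasSum.stein_poissonVecPmf (f := fun x ↦ (x i : ℝ) * F (∑ j, x j))
        ((hc i).congr_fun fun x ↦ ?_)
      rw [sum_add_single, Pi.add_apply, Pi.single_eq_same]
      push_cast
      ring
    refine (hasSum_sum (s := Finset.univ) fun i _ ↦ (h i).mul_left (lam i)⁻¹).congr_of_eq
      (fun x ↦ ?_) ?_
    · simp only [Finset.sum_mul]
      exact Finset.sum_congr rfl fun i _ ↦ by ring
    · exact Finset.sum_congr rfl fun i _ ↦ by rw [inv_mul_cancel_left₀ (hlam i).ne']
  · have h : HasSum (fun x : Fin m → ℕ ↦ (((∑ j, x j + 1 : ℕ) : ℝ) + m - 1) *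
        F (∑ j, x j + 1) * poissonVecPmf lam x) (∑ i, c i) := by
      refine (hasSum_sum (s := Finset.univ) fun i _ ↦ hc i).congr_fun fun x ↦ ?_
      simp only [Finset.sum_add_distrib, ← Finset.sum_mul, Finset.sum_const, Finset.card_univ,
        Fintype.card_fin, nsmul_eq_mul]
      push_cast
      ring
    refine ((HasSum.stein_poissonVecPmf_sum (F := fun n ↦ ((n : ℝ) + m - 1) * F n) h).mul_left
      (∑ i, lam i)⁻¹).congr_of_eq (fun x ↦ ?_) (inv_mul_cancel_left₀ hL.ne' _).symm
    ring

end Bounded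

/-- Conditional risk, given the total `z` of `X`, of an estimator `(a z + b z * y) * xᵢ`. -/
noncomputable def conditionalRisk (m : ℕ) (L : ℝ) (a b : ℕ → ℝ) (n : ℕ) : ℝ :=
  (n : ℝ) * ((n : ℝ) + m - 1) / L * (a n ^ 2 + 2 * a n * b n * L + b n ^ 2 * (L ^ 2 + L)) -
    2 * (n * (a n + b n * L)) + L

lemma risk_eq_tsum_conditionalRisk {m : ℕ} {lam : Fin m → ℝ} (hlam : ∀ i, 0 < lam i)
    (hL : 0 < ∑ i, lam i) {a b : ℕ → ℝ} {A B : ℝ} (ha : ∀ n, |a n| ≤ A) (hb : ∀ n, |b n| ≤ B)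
    {δ : (Fin m → ℕ) → ℕ → Fin m → ℝ}
    (hδ : ∀ x y i, δ x y i = (a (∑ j, x j) + b (∑ j, x j) * y) * x i) :
    Summable (fun x ↦ conditionalRisk m (∑ i, lam i) a b (∑ j, x j) * poissonVecPmf lam x) ∧
    0 ≤ ∑' x, conditionalRisk m (∑ i, lam i) a b (∑ j, x j) * poissonVecPmf lam x ∧
    risk m δ lam = ENNReal.ofReal
      (∑' x, conditionalRisk m (∑ i, lam i) a b (∑ j, x j) * poissonVecPmf lam x) := by
  set L := ∑ i, lam i with hLdef
  have hA : 0 ≤ A := (abs_nonneg _).trans (ha 0)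
  have hB : 0 ≤ B := (abs_nonneg _).trans (hb 0)
  set h : ℕ → ℝ := fun n ↦ a n ^ 2 + 2 * a n * b n * L + b n ^ 2 * (L ^ 2 + L)
  set φ : ℕ → ℝ := fun n ↦ a n + b n * L
  have hφ : ∀ n, |φ n| ≤ A + B * L := fun n ↦ by
    refine (abs_add_le _ _).trans ?_
    rw [abs_mul, abs_of_pos hL]
    gcongr
    exacts [ha n, hb n]
  have hh : ∀ n, |h n| ≤ A ^ 2 + 2 * A * B * L + B ^ 2 * (L ^ 2 + L) := fun n ↦ by
    refine (abs_add_three _ _ _).trans ?_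
    have hL2 : 0 < L ^ 2 + L := by positivity
    simp only [abs_mul, abs_pow, abs_two, abs_of_pos hL, abs_of_pos hL2]
    gcongr
    exacts [ha n, ha n, hb n, hb n]
  obtain ⟨T, hT₁, hT₂⟩ := exists_hasSum_sum_sq_div hlam hL hh
  have hs₁ := ((summable_sum_mul_poissonVecPmf hlam hφ).mul_left 2).hasSum
  have hs₀ := ((summable_poissonVecPmf hlam).mul_left L).hasSum
  have hcond : HasSum (fun x ↦ conditionalRisk m L a b (∑ j, x j) * poissonVecPmf lam x) _ :=
    ((hT₂.sub hs₁).add hs₀).congr_fun fun x ↦ by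
      simp only [conditionalRisk, h, φ]
      ring
  have hloss := (hT₁.sub hs₁).add hs₀
  rw [← hcond.tsum_eq] at hloss
  have hinner : ∀ x : Fin m → ℕ,
      HasSum (fun y : ℕ ↦ (∑ i, (δ x y i - lam i) ^ 2 / lam i) * jointPmf m lam x y)
        ((∑ i, (x i : ℝ) ^ 2 / lam i) * h (∑ j, x j) * poissonVecPmf lam x -
          2 * (((∑ j, x j : ℕ) : ℝ) * φ (∑ j, x j) * poissonVecPmf lam x) +
            L * poissonVecPmf lam x) := fun x ↦ by
    set S := ∑ i, (x i : ℝ) ^ 2 / lam i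
    set z := ∑ j, x j with hz
    have hexp : ∀ y : ℕ, ∑ i, (δ x y i - lam i) ^ 2 / lam i =
        (a z + b z * y) ^ 2 * S - 2 * (a z + b z * y) * z + L := fun y ↦ by
      rw [hz, hLdef]
      push_cast
      rw [Finset.mul_sum, Finset.mul_sum, ← Finset.sum_sub_distrib, ← Finset.sum_add_distrib]
      refine Finset.sum_congr rfl fun i _ ↦ ?_
      have := (hlam i).ne'
      rw [hδ]
      field_simp
      ring
    refine ((((hasSum_poissonPmf L).mul_left (a z ^ 2 * S - 2 * a z * z + L)).add
      (((hasSum_id_mul_poissonPmf L).mul_left (2 * a z * b z * S - 2 * b z * z)).add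
      ((hasSum_sq_mul_poissonPmf L).mul_left (b z ^ 2 * S)))).mul_right
        (poissonVecPmf lam x)).congr_of_eq (fun y ↦ ?_) ?_
    · rw [hexp]
      simp only [jointPmf, poissonVecPmf, ← hLdef]
      ring
    · simp only [h, φ]
      ring
  have hnn : ∀ (x : Fin m → ℕ) (y : ℕ),
      0 ≤ (∑ i, (δ x y i - lam i) ^ 2 / lam i) * jointPmf m lam x y := fun x y ↦
    mul_nonneg (Finset.sum_nonneg fun i _ ↦ div_nonneg (sq_nonneg _) (hlam i).le)
      (mul_nonneg (poissonPmf_pos hL y).le (poissonVecPmf_pos hlam x).le)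
  have hnn' := fun x ↦ (hinner x).nonneg (hnn x)
  refine ⟨hcond.summable, hloss.nonneg hnn', ?_⟩
  rw [← hloss.tsum_eq, ENNReal.ofReal_tsum_of_nonneg hnn' hloss.summable]
  refine tsum_congr fun x ↦ ?_
  rw [← (hinner x).tsum_eq, ENNReal.ofReal_tsum_of_nonneg (hnn x) (hinner x).summable]

/-- `E[(1 - Λ / (Z + 1)) 1_{Z ≥ 1}] = P(Z = 1) ≥ 0` for the total `Z`. -/
lemma summable_and_tsum_nonneg_one_sub_div {m : ℕ} {lam : Fin m → ℝ} (hlam : ∀ i, 0 < lam i)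
    {F : ℕ → ℝ} (hF : ∀ n, F n = if n = 0 then 0 else 1 - (∑ i, lam i) / (n + 1)) :
    Summable (fun x ↦ F (∑ j, x j) * poissonVecPmf lam x) ∧
      0 ≤ ∑' x, F (∑ j, x j) * poissonVecPmf lam x := by
  set L := ∑ i, lam i
  set G : ℕ → ℝ := fun n ↦ if n ≤ 1 then 0 else 1 / n
  set H : ℕ → ℝ := fun n ↦ if n = 0 then 0 else 1
  have hG : ∀ n, |G (n + 1)| ≤ 1 := fun n ↦ by
    simp only [G]
    split_ifs
    · simp
    · rw [abs_of_nonneg (by positivity), div_le_one (by positivity)]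
      push_cast
      linarith [(Nat.cast_nonneg n : (0 : ℝ) ≤ n)]
  have hH : ∀ n, |H n| ≤ 1 := fun n ↦ by
    simp only [H]
    split_ifs <;> simp
  have hG₀ := (summable_poissonVecPmf_of_bounded (F := fun n ↦ G (n + 1)) hlam hG).hasSum
  have hH₀ := (summable_poissonVecPmf_of_bounded hlam hH).hasSum
  have hFs := (hH₀.sub (hG₀.mul_left L)).congr_fun (g := fun x : Fin m → ℕ ↦
      F (∑ j, x j) * poissonVecPmf lam x) fun x ↦ by
    rw [hF]
    rcases Nat.eq_zero_or_pos (∑ j, x j) with h0 | h0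
    · simp [H, G, h0]
    · simp only [H, G, if_neg h0.ne', if_neg (show ¬(∑ j, x j + 1 ≤ 1) by omega)]
      push_cast
      ring
  refine ⟨hFs.summable, ?_⟩
  rw [hFs.tsum_eq, sub_nonneg]
  refine hasSum_le (fun x ↦ ?_) (HasSum.stein_poissonVecPmf_sum (F := G) hG₀) hH₀
  refine mul_le_mul_of_nonneg_right ?_ (poissonVecPmf_pos hlam x).le
  generalize ∑ j, x j = n
  simp only [H, G]
  rcases lt_trichotomy n 1 with h | rfl | h
  · simp [show n = 0 by omega]
  · simp
  · have : (n : ℝ) ≠ 0 := by positivity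
    simp [show ¬n ≤ 1 by omega, show n ≠ 0 by omega, this]

lemma conditionalRisk_sub {m : ℕ} (hm : 2 ≤ m) {L : ℝ} (hL : 0 < L) {n : ℕ} (hn : n ≠ 0)
    {a b a' b' : ℕ → ℝ}
    (ha : a n = 1 / 2) (hb : b n = 1 / (2 * ((n : ℝ) + m - 1)))
    (ha' : a' n = 1 / 2) (hb' : b' n = 1 / (2 * n)) :
    conditionalRisk m L a b n + ((m : ℝ) - 1) / 2 * (1 - L / (n + 1)) <
      conditionalRisk m L a' b' n := by
  obtain ⟨k, rfl⟩ : ∃ k, m = k + 2 := ⟨m - 2, by omega⟩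
  have hn' : (0 : ℝ) < n := by positivity
  have hk : (0 : ℝ) < (n : ℝ) + k + 1 := by positivity
  have hd : conditionalRisk (k + 2) L a' b' n - conditionalRisk (k + 2) L a b n =
      ((k : ℝ) + 1) / 4 * (2 + (L + 1) / n + (1 - 3 * L) / (n + k + 1)) := by
    simp only [conditionalRisk, ha, hb, ha', hb']
    push_cast
    rw [show (n : ℝ) + (k + 2) - 1 = n + k + 1 by ring]
    field_simp
    ring
  have h₁ : L / (n + 1) ≤ L / n := by gcongr; linarith
  have h₂ : L / (n + k + 1) ≤ L / (n + 1) := by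
    gcongr
    linarith [(Nat.cast_nonneg k : (0 : ℝ) ≤ k)]
  have h₃ : (0 : ℝ) < 1 / n := by positivity
  have h₄ : 0 < 1 / ((n : ℝ) + k + 1) := by positivity
  have h₅ : 0 < ((k : ℝ) + 1) / 4 *
      (2 + (L + 1) / n + (1 - 3 * L) / (n + k + 1) - 2 * (1 - L / (n + 1))) := by
    refine mul_pos (by positivity) ?_
    rw [add_div, sub_div, mul_div_assoc]
    linarith
  push_cast
  linarith

/- STATEMENT 2: for m ≥ 2, λ^O strictly dominates λ^ML at every parameter point. -/
theorem stmt_2 (m : ℕ) (hm : 2 ≤ m) (lam : Fin m → ℝ) (hlam : ∀ i, 0 < lam i) :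
    risk m (estO m) lam < risk m (estML m) lam := by
  have hm' : (2 : ℝ) ≤ m := by exact_mod_cast hm
  let i₀ : Fin m := ⟨0, by omega⟩
  have hL : 0 < ∑ i, lam i := Finset.sum_pos (fun i _ ↦ hlam i) ⟨i₀, Finset.mem_univ _⟩
  set a : ℕ → ℝ := fun n ↦ ((n : ℝ) + m - 1) / 2 / ((n : ℝ) + m - 1)
  set b : ℕ → ℝ := fun n ↦ 1 / (2 * ((n : ℝ) + m - 1))
  set a' : ℕ → ℝ := fun n ↦ (n : ℝ) / 2 / n
  set b' : ℕ → ℝ := fun n ↦ 1 / (2 * (n : ℝ))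
  have hpos : ∀ n : ℕ, 1 ≤ (n : ℝ) + m - 1 := fun n ↦ by
    linarith [(Nat.cast_nonneg n : (0 : ℝ) ≤ n)]
  have ha_eq : ∀ n, a n = 1 / 2 := fun n ↦ by
    have := hpos n
    simp only [a]
    field_simp
  have ha'_eq : ∀ n ≠ 0, a' n = 1 / 2 := fun n hn ↦ by
    have : (n : ℝ) ≠ 0 := by exact_mod_cast hn
    simp only [a']
    field_simp
  have ha : ∀ n, |a n| ≤ 1 := fun n ↦ by
    rw [ha_eq]
    norm_num [abs_le]
  have ha' : ∀ n, |a' n| ≤ 1 := fun n ↦ by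
    rcases eq_or_ne n 0 with rfl | hn
    · simp [a']
    · rw [ha'_eq n hn]
      norm_num [abs_le]
  have hb : ∀ n, |b n| ≤ 1 := fun n ↦ by
    have := hpos n
    simp only [b]
    rw [abs_of_nonneg (by positivity), div_le_one (by positivity)]
    linarith
  have hb' : ∀ n, |b' n| ≤ 1 := fun n ↦ by
    rcases Nat.eq_zero_or_pos n with rfl | hn
    · simp [b']
    · have : (1 : ℝ) ≤ n := by exact_mod_cast hn
      simp only [b']
      rw [abs_of_nonneg (by positivity), div_le_one (by positivity)]
      linarith
  obtain ⟨hO, hO₀, hO_eq⟩ := risk_eq_tsum_conditionalRisk (δ := estO m) hlam hL ha hb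
    fun x y i ↦ by
      simp only [estO, a, b, mul_inv, div_eq_mul_inv]
      push_cast
      ring
  obtain ⟨hML, -, hML_eq⟩ := risk_eq_tsum_conditionalRisk (δ := estML m) hlam hL ha' hb'
    fun x y i ↦ by
      simp only [estML, a', b']
      push_cast
      ring
  rw [hO_eq, hML_eq, ENNReal.ofReal_lt_ofReal_iff_of_nonneg hO₀]
  obtain ⟨hF, hF₀⟩ := summable_and_tsum_nonneg_one_sub_div hlam fun _ ↦ rfl
  have hF₁ := hF.mul_left (((m : ℝ) - 1) / 2)
  have hF₂ := mul_nonneg (show (0 : ℝ) ≤ ((m : ℝ) - 1) / 2 by linarith) hF₀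
  rw [← tsum_mul_left] at hF₂
  refine lt_of_le_of_lt (le_add_of_nonneg_right hF₂) ?_
  rw [← hO.tsum_add hF₁]
  have hlt : ∀ x : Fin m → ℕ, ∑ j, x j ≠ 0 → _ := fun x hx ↦
    mul_lt_mul_of_pos_right (conditionalRisk_sub (b := b) (b' := b') hm hL hx (ha_eq _) rfl
      (ha'_eq _ hx) rfl)
      (poissonVecPmf_pos hlam x)
  refine Summable.tsum_lt_tsum (i := Pi.single i₀ 1) (fun x ↦ ?_) ?_ (hO.add hF₁) hML
  · rcases eq_or_ne (∑ j, x j) 0 with hx | hx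
    · simp [hx, conditionalRisk]
    · refine (le_of_eq ?_).trans (hlt x hx).le
      rw [if_neg hx]
      ring
  · have hx : ∑ j, (Pi.single i₀ 1 : Fin m → ℕ) j ≠ 0 := by simp
    refine (le_of_eq ?_).trans_lt (hlt _ hx)
    rw [if_neg hx]
    ring
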